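/- In the Baumslag-Solitar group BS(1,q) = ⟨a, y | y a y^{-1} = a^q⟩ with q ≥ 2, for integers k and ℓ: a^k is conjugate to a^ℓ if and only if there exists j ∈ ℤ with ℓ = k·q^j (where for j < 0 this requires q^{-j} | k). -/

import Mathlib

/-- The defining relation of the Baumslag-Solitar group `BS(p,q)`:
`y a^p y⁻¹ = a^q`, where `a` is the letter `false` and `y` the letter `true`. -/
def BSRel (p q : ℤ) : Set (FreeGroup Bool) :=
  { FreeGroup.of true * (FreeGroup.of false) ^ p * (FreeGroup.of true)⁻¹ *
      ((FreeGroup.of false) ^ q)⁻¹ }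

/-- The Baumslag-Solitar group `BS(p,q) = ⟨a, y | y a^p y⁻¹ = a^q⟩`. -/
abbrev BS (p q : ℤ) : Type := PresentedGroup (BSRel p q)

/-- Translation by one and multiplication by `q` on `ℚ`. -/
noncomputable def bsGen (q : ℚ) (hq : q ≠ 0) : Bool → Equiv.Perm ℚ
  | false => Equiv.addRight 1
  | true => Equiv.mulRight₀ q hq

lemma addRight_one_zpow (k : ℤ) (x : ℚ) :
    ((Equiv.addRight (1 : ℚ)) ^ k : Equiv.Perm ℚ) x = x + k := by
  induction k generalizing x with
  | zero => simp
  | succ n ih =>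
    rw [zpow_add_one, Equiv.Perm.mul_apply, ih]
    simp
    ring
  | pred n ih =>
    rw [zpow_sub_one, Equiv.Perm.mul_apply, ih]
    have : (Equiv.addRight (1 : ℚ))⁻¹ x = x - 1 := by
      rw [Equiv.Perm.inv_eq_iff_eq]
      simp
    rw [this]
    push_cast
    ring

lemma bsGen_rel (q : ℤ) (hq : (q : ℚ) ≠ 0) :
    ∀ r ∈ BSRel 1 q, FreeGroup.lift (bsGen (q : ℚ) hq) r = 1 := by
  intro r hr
  rw [BSRel, Set.mem_singleton_iff] at hr
  subst hr
  simp only [map_mul, map_inv, map_zpow, FreeGroup.lift_apply_of, zpow_one]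
  rw [mul_inv_eq_one, mul_inv_eq_iff_eq_mul]
  ext x
  rw [Equiv.Perm.mul_apply, Equiv.Perm.mul_apply]
  simp only [bsGen]
  rw [addRight_one_zpow]
  simp
  ring

lemma lift_affine (q : ℚ) (hq : q ≠ 0) (w : FreeGroup Bool) :
    ∃ (j : ℤ) (c : ℚ), ∀ x, FreeGroup.lift (bsGen q hq) w x = q ^ j * x + c := by
  induction w using FreeGroup.induction_on with
  | C1 => exact ⟨0, 0, fun x => by simp⟩
  | of b =>
    cases b
    · exact ⟨0, 1, fun x => by simp [bsGen]⟩
    · exact ⟨1, 0, fun x => by simp [bsGen, mul_comm]⟩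
  | inv_of b _ =>
    cases b
    · refine ⟨0, -1, fun x => ?_⟩
      rw [map_inv, Equiv.Perm.inv_eq_iff_eq]
      simp [bsGen]
    · refine ⟨-1, 0, fun x => ?_⟩
      rw [map_inv, Equiv.Perm.inv_eq_iff_eq]
      simp [bsGen]
      field_simp
  | mul u v hu hv =>
    obtain ⟨j, c, h⟩ := hu
    obtain ⟨j', c', h'⟩ := hv
    refine ⟨j + j', q ^ j * c' + c, fun x => ?_⟩
    rw [map_mul, Equiv.Perm.mul_apply, h, h', zpow_add₀ hq]
    ring

lemma bs_conj_one (q k : ℤ) :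
    IsConj ((PresentedGroup.of false : BS 1 q) ^ k)
      ((PresentedGroup.of false : BS 1 q) ^ (k * q)) := by
  have h : (PresentedGroup.of true : BS 1 q) * PresentedGroup.of false *
      (PresentedGroup.of true)⁻¹ = PresentedGroup.of false ^ q := by
    have := PresentedGroup.one_of_mem (rels := BSRel 1 q) (Set.mem_singleton _)
    simp only [map_mul, map_inv, map_zpow, zpow_one] at this
    exact mul_inv_eq_one.mp this
  rw [isConj_iff]
  refine ⟨PresentedGroup.of true, ?_⟩
  rw [← conj_zpow, h, ← zpow_mul, mul_comm]

lemma bs_conj_pow (q k : ℤ) (n : ℕ) :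
    IsConj ((PresentedGroup.of false : BS 1 q) ^ k)
      ((PresentedGroup.of false : BS 1 q) ^ (k * q ^ n)) := by
  induction n with
  | zero => rw [pow_zero, mul_one]
  | succ n ih =>
    rw [pow_succ, ← mul_assoc]
    exact ih.trans (bs_conj_one q _)

/-- In the solvable Baumslag-Solitar group `BS(1,q)` with `q ≥ 2`, the elements `a^k`
and `a^ℓ` are conjugate iff `ℓ = k·q^j` for some integer `j` (where for `j < 0` the
equation over `ℚ` encodes the divisibility requirement `q^{-j} ∣ k`). -/
theorem stmt15 (q : ℤ) (hq : 2 ≤ q) (k ℓ : ℤ) :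
    IsConj ((PresentedGroup.of false : BS 1 q) ^ k)
        ((PresentedGroup.of false : BS 1 q) ^ ℓ) ↔
      ∃ j : ℤ, (ℓ : ℚ) = (k : ℚ) * (q : ℚ) ^ j := by
  have hq0 : (q : ℚ) ≠ 0 := by
    have : q ≠ 0 := by lia
    exact_mod_cast this
  constructor
  · intro h
    obtain ⟨g, hg⟩ := isConj_iff.mp h
    rw [mul_inv_eq_iff_eq_mul] at hg
    obtain ⟨w, rfl⟩ := PresentedGroup.mk_surjective _ g
    obtain ⟨j, c, hw⟩ := lift_affine (q : ℚ) hq0 w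
    have h1 := congrArg (PresentedGroup.toGroup (bsGen_rel q hq0)) hg
    have hmk : PresentedGroup.toGroup (bsGen_rel q hq0) (PresentedGroup.mk _ w)
      = FreeGroup.lift (bsGen (q : ℚ) hq0) w := rfl
    simp only [map_mul, map_zpow, PresentedGroup.toGroup.of, hmk] at h1
    have h2 := congrArg (fun f : Equiv.Perm ℚ => f 0) h1
    simp only [Equiv.Perm.mul_apply, hw] at h2
    simp only [bsGen, addRight_one_zpow] at h2
    exact ⟨j, by linarith⟩
  · rintro ⟨j, hj⟩
    obtain ⟨n, rfl | rfl⟩ := j.eq_nat_or_neg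
    · have : ℓ = k * q ^ n := by
        rw [zpow_natCast] at hj
        exact_mod_cast hj
      rw [this]
      exact bs_conj_pow q k n
    · have : k = ℓ * q ^ n := by
        rw [zpow_neg, zpow_natCast, eq_mul_inv_iff_mul_eq₀ (pow_ne_zero _ hq0)] at hj
        exact_mod_cast hj.symm
      rw [this]
      exact (bs_conj_pow q ℓ n).symm
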